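/- arXiv:2504.05965 — 2 statements merged into one kernel-verified Lean document; each statement's English description precedes it below -/
import Mathlib

section
/- For every tightening transformation t and every pMC D, the pMCs D and t(D) have the same well-defined instantiations and equal reachability probabilities at every well-defined instantiation, i.e., D ≡ t(D). -/
/-!
Formalization preliminaries: Markov chains (MCs), interval Markov chains (iMCs),
parametric Markov chains (pMCs), regions, interval substitution, sub-pMCs,
the shortcut and grouping transformations, and EC elimination.
-/

open Classical
noncomputable section

/-- A Markov chain over a finite state space `S`. -/
structure MC (S : Type) [Fintype S] where
  init : S
  P : S → S → ℝ
  nonneg : ∀ s t, 0 ≤ P s t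
  rowSum : ∀ s, ∑ t, P s t = 1

variable {S S₂ V : Type} [Fintype S] [Fintype S₂] [Fintype V]

/-- `n`-step bounded reachability probability. -/
def reachAux (M : MC S) (good : Set S) : ℕ → S → ℝ
  | 0, s => if s ∈ good then 1 else 0
  | n + 1, s => if s ∈ good then 1 else ∑ t, M.P s t * reachAux M good n t

/-- The probability that a run of `M` started in `s` eventually reaches `good`. -/
def reachProb (M : MC S) (good : Set S) (s : S) : ℝ :=
  ⨆ n, reachAux M good n s

/-- An interval Markov chain over a finite state space `S`: each transition
carries a closed interval `[lo s t, hi s t]`. -/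
structure IMC (S : Type) [Fintype S] where
  init : S
  lo : S → S → ℝ
  hi : S → S → ℝ

/-- The set `MC(I)` of Markov chains induced by an iMC. -/
def IMC.MCs (I : IMC S) : Set (MC S) :=
  {M | M.init = I.init ∧ ∀ s t, I.lo s t ≤ M.P s t ∧ M.P s t ≤ I.hi s t}

/-- The set of reachability probabilities (from state `s`) realized by the MCs of an iMC. -/
def reachVals (I : IMC S) (good : Set S) (s : S) : Set ℝ :=
  {r | ∃ M ∈ I.MCs, r = reachProb M good s}

/-- The reachability interval `⟨⟨I⟩⟩` of an iMC. -/
def reachInterval (I : IMC S) (good : Set S) : Set ℝ :=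
  Set.Icc (sInf (reachVals I good I.init)) (sSup (reachVals I good I.init))

/-- `I` refines `I'`: same states and initial state, and each transition interval of `I`
is contained in the corresponding interval of `I'`. -/
def IMC.Refines (I I' : IMC S) : Prop :=
  I.init = I'.init ∧ ∀ s t, I'.lo s t ≤ I.lo s t ∧ I.hi s t ≤ I'.hi s t

/-- The set of states of an iMC with zero reachability probability of reaching `good`
(in every induced MC). -/
def badSet (I : IMC S) (good : Set S) : Set S :=
  {s | ∀ M ∈ I.MCs, reachProb M good s = 0}

/-- A solution of the iMC system of equations of `I` (for `opt ∈ {sInf, sSup}`):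
`x s = 1` on `good`, `x s = 0` on `bad`, and otherwise `x s` is the optimum over all
weighted sums given by distributions chosen within the transition intervals. -/
def IsSolution (I : IMC S) (good bad : Set S) (opt : Set ℝ → ℝ) (x : S → ℝ) : Prop :=
  (∀ s ∈ good, x s = 1) ∧ (∀ s ∈ bad, x s = 0) ∧
    ∀ s, s ∉ good → s ∉ bad →
      x s = opt {y | ∃ a : S → ℝ,
        (∀ t, I.lo s t ≤ a t ∧ a t ≤ I.hi s t) ∧ (∑ t, a t) = 1 ∧ y = ∑ t, a t * x t}

/-- `S'` is a bottom strongly connected component of the MC `M`: nonempty, closed under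
transitions with positive probability, and strongly connected. -/
def IsBSCC (M : MC S) (S' : Set S) : Prop :=
  S'.Nonempty ∧ (∀ s ∈ S', ∀ t, 0 < M.P s t → t ∈ S') ∧
    ∀ s ∈ S', ∀ t ∈ S', Relation.ReflTransGen (fun a b => 0 < M.P a b) s t

/-- `S'` is an end component of the iMC `I`: a BSCC of some `M ∈ MC(I)`. -/
def IsEC (I : IMC S) (S' : Set S) : Prop := ∃ M ∈ I.MCs, IsBSCC M S'

/-- `S'` is a maximal end component of the iMC `I`. -/
def IsMEC (I : IMC S) (S' : Set S) : Prop :=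
  IsEC I S' ∧ ∀ T, IsEC I T → S' ⊆ T → T = S'

/-! ### EC elimination (characterized as a predicate) -/

/-- The MECs of `I` that are disjoint from `good ∪ bad`. -/
def MECsAway (I : IMC S) (good bad : Set S) : Set (Set S) :=
  {T | IsMEC I T ∧ T ∩ (good ∪ bad) = ∅}

/-- `J` together with the collapsing map `hat` is the EC elimination `elim(I)` of `I`:
`hat` surjects onto the states of `J` and collapses exactly the MECs disjoint from
`good ∪ bad`, and the transition intervals of `J` are as prescribed by the definition
of EC elimination ( `[0,1]` out of a collapsed MEC towards a distinct class reachable in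
`I` or towards `bad`, the original intervals from non-collapsed states, and `[0,0]`
otherwise). -/
def IsElim (I : IMC S) (good bad : Set S) (J : IMC S₂) (hat : S → S₂) : Prop :=
  Function.Surjective hat ∧
  (∀ s t : S, hat s = hat t ↔ (s = t ∨ ∃ T ∈ MECsAway I good bad, s ∈ T ∧ t ∈ T)) ∧
  J.init = hat I.init ∧
  ∀ s t : S,
    ((∃ T ∈ MECsAway I good bad, s ∈ T) →
      (((hat s ≠ hat t ∧
          ∃ s' t', hat s' = hat s ∧ hat t' = hat t ∧ ¬(I.lo s' t' = 0 ∧ I.hi s' t' = 0)) ∨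
         (∃ t' ∈ bad, hat t' = hat t)) →
            J.lo (hat s) (hat t) = 0 ∧ J.hi (hat s) (hat t) = 1) ∧
      (¬((hat s ≠ hat t ∧
          ∃ s' t', hat s' = hat s ∧ hat t' = hat t ∧ ¬(I.lo s' t' = 0 ∧ I.hi s' t' = 0)) ∨
         (∃ t' ∈ bad, hat t' = hat t)) →
            J.lo (hat s) (hat t) = 0 ∧ J.hi (hat s) (hat t) = 0)) ∧
    (¬(∃ T ∈ MECsAway I good bad, s ∈ T) →
      J.lo (hat s) (hat t) = ∑ t' ∈ Finset.univ.filter (fun t' => hat t' = hat t), I.lo s t' ∧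
      J.hi (hat s) (hat t) = ∑ t' ∈ Finset.univ.filter (fun t' => hat t' = hat t), I.hi s t')

/-! ### Parametric Markov chains -/

/-- A parametric Markov chain over finite state space `S` and parameters `V`;
transition probabilities are polynomials over the parameters. -/
structure PMC (S V : Type) [Fintype S] [Fintype V] where
  init : S
  P : S → S → MvPolynomial V ℝ

/-- The instantiated transition value `P(s,t)[u]`. -/
def PMC.ev (D : PMC S V) (u : V → ℝ) (s t : S) : ℝ := MvPolynomial.eval u (D.P s t)

/-- The instantiation `u` is well defined for `D`, i.e. `D[u]` is a Markov chain. -/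
def WD (D : PMC S V) (u : V → ℝ) : Prop :=
  (∀ s t, 0 ≤ D.ev u s t) ∧ ∀ s, ∑ t, D.ev u s t = 1

/-- The instantiated Markov chain `D[u]` of a well-defined instantiation. -/
def PMC.toMC (D : PMC S V) (u : V → ℝ) (h : WD D u) : MC S :=
  ⟨D.init, D.ev u, h.1, h.2⟩

/-- A region: the product of closed intervals `[lo p, hi p]`, one per parameter,
where the parameters in `Dd` are discrete (integer valued). -/
def Region (lo hi : V → ℝ) (Dd : Set V) : Set (V → ℝ) :=
  {u | ∀ p, lo p ≤ u p ∧ u p ≤ hi p ∧ (p ∈ Dd → ∃ k : ℤ, u p = (k : ℝ))}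

/-- The set `wd_D(R)` of well-defined instantiations of `D` within `R`. -/
def wdSet (D : PMC S V) (R : Set (V → ℝ)) : Set (V → ℝ) := {u ∈ R | WD D u}

/-- The iMC `I` substitutes the pMC `D` in `R`: `D[u] ∈ MC(I)` for every `u ∈ wd_D(R)`. -/
def Substitutes (I : IMC S) (D : PMC S V) (R : Set (V → ℝ)) : Prop :=
  I.init = D.init ∧ ∀ u ∈ wdSet D R, ∀ s t, I.lo s t ≤ D.ev u s t ∧ D.ev u s t ≤ I.hi s t

/-- `I` is the interval substitution `isub_R(D)`: the maximally refined iMC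
substituting `D` in `R`. -/
def IsISub (D : PMC S V) (R : Set (V → ℝ)) (I : IMC S) : Prop :=
  Substitutes I D R ∧ ∀ J : IMC S, Substitutes J D R → I.Refines J

/-- `[a,b]` is a region estimate for `D` in `R` (w.r.t. the target set `good`). -/
def IsRegionEstimate (D : PMC S V) (R : Set (V → ℝ)) (good : Set S) (a b : ℝ) : Prop :=
  ∀ u ∈ R, ∀ h : WD D u,
    a ≤ reachProb (D.toMC u h) good D.init ∧ reachProb (D.toMC u h) good D.init ≤ b

/-! ### Sub-pMCs and the shortcut transformation -/

/-- The exit states of a candidate sub-pMC on the state set `Shat`: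
states with no nonzero transition inside `Shat`. -/
def exitSet (D : PMC S V) (Shat : Finset S) : Finset S :=
  Shat.filter fun s => ∀ t ∈ Shat, D.P s t = 0

/-- The edge relation of the underlying graph of the sub-pMC on `Shat`. -/
def subEdge (D : PMC S V) (Shat : Finset S) (a b : S) : Prop :=
  a ∈ Shat ∧ b ∈ Shat ∧ D.P a b ≠ 0

/-- `(Shat, shat)` carries a sub-pMC of `D` rooted in `shat` over the single parameter `p`:
the underlying graph is acyclic, every state is reachable from `shat`, and every non-exit
state has all its transitions inside `Shat`, given by univariate polynomials over `p`
with rational coefficients. -/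
def IsSubPMC (D : PMC S V) (Shat : Finset S) (shat : S) (p : V) : Prop :=
  shat ∈ Shat ∧
  (∀ s, ¬ Relation.TransGen (subEdge D Shat) s s) ∧
  (∀ s ∈ Shat, Relation.ReflTransGen (subEdge D Shat) shat s) ∧
  ∀ s ∈ Shat, s ∉ exitSet D Shat → ∀ t : S,
    (D.P s t ≠ 0 → t ∈ Shat) ∧
    D.P s t ∈ MvPolynomial.supported ℝ ({p} : Set V) ∧
    (∀ m, MvPolynomial.coeff m (D.P s t) ∈ Set.range ((↑) : ℚ → ℝ))

/-- The product of the transition polynomials along a path (a list of states). -/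
def pathProd (D : PMC S V) (l : List S) : MvPolynomial V ℝ :=
  ((l.zip l.tail).map fun q => D.P q.1 q.2).prod

/-- The set of paths from `a` to `b` inside `Shat` in the underlying graph of the sub-pMC. -/
def PathSet (D : PMC S V) (Shat : Finset S) (a b : S) : Set (List S) :=
  {l | l.head? = some a ∧ l.getLast? = some b ∧ (∀ x ∈ l, x ∈ Shat) ∧
       l.Chain' fun x y => D.P x y ≠ 0}

/-- The shortcut transition polynomial `Pr^{D_{ŝ,p}}(a ⟿ b)`:
the sum over all paths from `a` to `b` of the products of transition polynomials. -/
def shortcutPoly (D : PMC S V) (Shat : Finset S) (a b : S) : MvPolynomial V ℝ :=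
  ∑ᶠ l ∈ PathSet D Shat a b, pathProd D l

/-- The shortcut pMC `t_shortcut(D, D_{ŝ,p})`. -/
def shortcutPMC (D : PMC S V) (Shat : Finset S) (shat : S) : PMC S V where
  init := D.init
  P s t :=
    if s = shat then
      (if t ∈ exitSet D Shat then shortcutPoly D Shat shat t else 0)
    else D.P s t

/-! ### The grouping transformation -/

/-- Transition function of the grouped pMC `t_group(D, ŝ, f)`; the fresh state `s'`
is modelled by `none`. -/
def groupP (D : PMC S V) (shat : S) {k : ℕ} (sfun : Fin k → S)
    (f : MvPolynomial V ℝ) (g : Fin k → MvPolynomial V ℝ) (c : Fin k → ℚ) :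
    Option S → Option S → MvPolynomial V ℝ
  | some s, some t =>
      if s = shat then (if h : ∃ i, sfun i = t then g h.choose else D.P shat t)
      else D.P s t
  | some s, none => if s = shat then MvPolynomial.C ((∑ i, c i : ℚ) : ℝ) * f else 0
  | none, some t =>
      if h : ∃ i, sfun i = t then MvPolynomial.C ((c h.choose / ∑ i, c i : ℚ) : ℝ) else 0
  | none, none => 0

/-- The grouped pMC `t_group(D, ŝ, f)`. -/
def groupPMC (D : PMC S V) (shat : S) {k : ℕ} (sfun : Fin k → S)
    (f : MvPolynomial V ℝ) (g : Fin k → MvPolynomial V ℝ) (c : Fin k → ℚ) :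
    PMC (Option S) V :=
  ⟨some D.init, groupP D shat sfun f g c⟩

/-! ### pMCs with states `Fin n` (transformations may change the state space) -/

/-- A pMC over parameter set `V` with state space `Fin n` and a designated target set. -/
structure PMCn (V : Type) [Fintype V] where
  n : ℕ
  M : PMC (Fin n) V
  good : Set (Fin n)

/-- Relabelling the states of a pMC along an equivalence. -/
def PMC.relabel (e : S ≃ S₂) (D : PMC S V) : PMC S₂ V :=
  ⟨e D.init, fun s t => D.P (e.symm s) (e.symm t)⟩

/-- A shortcut step on a `PMCn`. -/
def shortcutStep (D : PMCn V) (Shat : Finset (Fin D.n)) (shat : Fin D.n) : PMCn V :=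
  ⟨D.n, shortcutPMC D.M Shat shat, D.good⟩

/-- A grouping step on a `PMCn`; the fresh state is `(finSuccEquiv D.n).symm none`. -/
def groupStep (D : PMCn V) (shat : Fin D.n) {k : ℕ} (sfun : Fin k → Fin D.n)
    (f : MvPolynomial V ℝ) (g : Fin k → MvPolynomial V ℝ) (c : Fin k → ℚ) : PMCn V :=
  ⟨D.n + 1, PMC.relabel (finSuccEquiv D.n).symm (groupPMC D.M shat sfun f g c),
    (fun s => (finSuccEquiv D.n).symm (some s)) '' D.good⟩

/-- A single big-step transformation step: either a shortcut transformation on some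
sub-pMC, or a grouping transformation. The parameter set `V` is preserved. -/
def Step (D D' : PMCn V) : Prop :=
  (∃ (Shat : Finset (Fin D.n)) (shat : Fin D.n) (p : V),
      IsSubPMC D.M Shat shat p ∧ D' = shortcutStep D Shat shat) ∨
  (∃ (shat : Fin D.n) (k : ℕ) (sfun : Fin k → Fin D.n)
      (f : MvPolynomial V ℝ) (g : Fin k → MvPolynomial V ℝ) (c : Fin k → ℚ),
      Function.Injective sfun ∧
      (∀ i, D.M.P shat (sfun i) = g i + MvPolynomial.C ((c i : ℝ)) * f) ∧
      (∑ i, c i) ≠ 0 ∧ D' = groupStep D shat sfun f g c)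

/-- `t` is a tightening transformation on pMCs over the parameter set `V`:
for every pMC `D` and every region `R`, `wd_{t(D)}(R) = wd_D(R)` and
`isub_R(t(D))` tightens `isub_R(D)`. -/
def IsTightening (t : PMCn V → PMCn V) : Prop :=
  ∀ (D : PMCn V) (lo hi : V → ℝ) (Dd : Set V),
    wdSet (t D).M (Region lo hi Dd) = wdSet D.M (Region lo hi Dd) ∧
    ∀ (I : IMC (Fin D.n)) (J : IMC (Fin (t D).n)),
      IsISub D.M (Region lo hi Dd) I → IsISub (t D).M (Region lo hi Dd) J →
      reachInterval J (t D).good ⊆ reachInterval I D.good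

lemma region_point {V : Type} (u w : V → ℝ) : w ∈ Region u u ∅ ↔ w = u := by
  constructor
  · intro h
    funext p
    exact le_antisymm (h p).2.1 (h p).1
  · rintro rfl p
    exact ⟨le_rfl, le_rfl, fun h => h.elim⟩

/-- The point iMC of an instantiation. -/
def pointIMC {S V : Type} [Fintype S] [Fintype V] (D : PMC S V) (u : V → ℝ) : IMC S :=
  ⟨D.init, D.ev u, D.ev u⟩

lemma pointIMC_isISub {S V : Type} [Fintype S] [Fintype V] (D : PMC S V) (u : V → ℝ)
    (h : WD D u) : IsISub D (Region u u ∅) (pointIMC D u) := by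
  refine ⟨⟨rfl, ?_⟩, ?_⟩
  · rintro w ⟨hw, -⟩ s t
    rw [region_point] at hw
    subst hw
    exact ⟨le_rfl, le_rfl⟩
  · rintro J ⟨hi, hJ⟩
    exact ⟨hi.symm, hJ u ⟨(region_point u u).2 rfl, h⟩⟩

lemma pointIMC_MCs {S V : Type} [Fintype S] [Fintype V] (D : PMC S V) (u : V → ℝ)
    (h : WD D u) : (pointIMC D u).MCs = {D.toMC u h} := by
  ext M
  constructor
  · rintro ⟨h1, h2⟩
    obtain ⟨i, P, a, b⟩ := M
    have hP : P = D.ev u := by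
      funext s t
      exact le_antisymm (h2 s t).2 (h2 s t).1
    have hi : i = D.init := h1
    subst hP hi
    rfl
  · rintro rfl
    exact ⟨rfl, fun s t => ⟨le_rfl, le_rfl⟩⟩

lemma pointIMC_interval {S V : Type} [Fintype S] [Fintype V] (D : PMC S V) (u : V → ℝ)
    (h : WD D u) (good : Set S) :
    reachInterval (pointIMC D u) good = {reachProb (D.toMC u h) good D.init} := by
  have : reachVals (pointIMC D u) good (pointIMC D u).init
      = {reachProb (D.toMC u h) good D.init} := by
    ext r
    simp only [reachVals, pointIMC_MCs D u h]
    simp [pointIMC]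
  rw [reachInterval, this, csInf_singleton, csSup_singleton, Set.Icc_self]

/-- For every tightening transformation `t` and every pMC `D`, the pMCs
`D` and `t(D)` have the same well-defined instantiations and equal reachability
probabilities at every well-defined instantiation, i.e. `D ≡ t(D)`. -/
theorem tightening_preserves_reachability
    {V : Type} [Fintype V]
    (t : PMCn V → PMCn V) (ht : IsTightening t) (D : PMCn V) :
    (∀ u : V → ℝ, WD D.M u ↔ WD (t D).M u) ∧
    ∀ (u : V → ℝ) (h : WD D.M u) (h' : WD (t D).M u),
      reachProb (D.M.toMC u h) D.good D.M.init =
        reachProb ((t D).M.toMC u h') (t D).good (t D).M.init := by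
  refine ⟨fun u => ?_, fun u h h' => ?_⟩
  · have := Set.ext_iff.1 (ht D u u ∅).1 u
    simp only [wdSet, Set.mem_setOf_eq, region_point, true_and] at this
    exact this.symm
  · have := (ht D u u ∅).2 _ _ (pointIMC_isISub D.M u h) (pointIMC_isISub (t D).M u h')
    rw [pointIMC_interval D.M u h, pointIMC_interval (t D).M u h'] at this
    exact (Set.singleton_subset_singleton.1 this).symm

end
end

section
/- Let D be a pMC with a grouping at state ŝ given by states S' = {s_1, …, s_k}, polynomials f, g_1, …, g_k and rationals c_1, …, c_k > 0 with P(ŝ, s_i) = g_i + c_i·f and c = Σ_j c_j. Assume that for every instantiation u that is well defined for D, f[u] ≥ 0 and g_i[u] ≥ 0 for all i. Then every such u is also well defined for the grouped pMC t_group(D, ŝ, f): the outgoing transition values at ŝ and at the fresh state s' lie in [0,1] and each sums to one. In particular wd_{t_group(D, ŝ, f)}(R) = wd_D(R) for every region R. -/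
/-!
Formalization preliminaries: Markov chains (MCs), interval Markov chains (iMCs),
parametric Markov chains (pMCs), regions, interval substitution, sub-pMCs,
the shortcut and grouping transformations, and EC elimination.
-/

open Classical
noncomputable section

variable {S S₂ V : Type} [Fintype S] [Fintype S₂] [Fintype V]

/-- Let `D` be a pMC with a grouping at `ŝ` with `c_i > 0`, and assume
that `f` and all `g_i` evaluate nonnegatively on every well-defined instantiation. Then
every instantiation `u` well defined for `D` is also well defined for the grouped pMC
`t_group(D, ŝ, f)`: the outgoing transition values at `ŝ` and at the fresh state `s'`
lie in `[0,1]` and each row sums to one. In particular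
`wd_{t_group(D, ŝ, f)}(R) = wd_D(R)` for every region `R`. -/
theorem grouping_preserves_wd
    {S V : Type} [Fintype S] [Fintype V]
    (D : PMC S V) (shat : S)
    (k : ℕ) (hk : 0 < k) (sfun : Fin k → S) (hinj : Function.Injective sfun)
    (f : MvPolynomial V ℝ) (g : Fin k → MvPolynomial V ℝ) (c : Fin k → ℚ)
    (hP : ∀ i, D.P shat (sfun i) = g i + MvPolynomial.C ((c i : ℝ)) * f)
    (hcpos : ∀ i, 0 < c i)
    (hf : ∀ u : V → ℝ, WD D u → 0 ≤ MvPolynomial.eval u f)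
    (hg : ∀ u : V → ℝ, WD D u → ∀ i, 0 ≤ MvPolynomial.eval u (g i)) :
    (∀ u : V → ℝ, WD D u →
      ((∀ b, 0 ≤ (groupPMC D shat sfun f g c).ev u (some shat) b ∧
             (groupPMC D shat sfun f g c).ev u (some shat) b ≤ 1) ∧
       (∑ b, (groupPMC D shat sfun f g c).ev u (some shat) b) = 1 ∧
       (∀ b, 0 ≤ (groupPMC D shat sfun f g c).ev u none b ∧
             (groupPMC D shat sfun f g c).ev u none b ≤ 1) ∧
       (∑ b, (groupPMC D shat sfun f g c).ev u none b) = 1 ∧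
       WD (groupPMC D shat sfun f g c) u)) ∧
    ∀ (lo hi : V → ℝ) (Dd : Set V),
      wdSet (groupPMC D shat sfun f g c) (Region lo hi Dd) = wdSet D (Region lo hi Dd) := by
  have hC : (0:ℝ) < ((∑ i, c i : ℚ) : ℝ) := by
    have : 0 < ∑ i, c i :=
      Finset.sum_pos (fun i _ => hcpos i) ⟨⟨0, hk⟩, Finset.mem_univ _⟩
    exact_mod_cast this
  obtain ⟨C, hCdef⟩ : ∃ C : ℝ, C = ((∑ i, c i : ℚ) : ℝ) := ⟨_, rfl⟩
  rw [← hCdef] at hC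
  let cc : S → ℝ := fun t => if h : ∃ i, sfun i = t then (c h.choose : ℝ) else 0
  have hcc : ∀ i, cc (sfun i) = (c i : ℝ) := by
    intro i
    have h : ∃ j, sfun j = sfun i := ⟨i, rfl⟩
    have h2 : h.choose = i := hinj h.choose_spec
    simp only [cc, dif_pos h, h2]
  have hcc0 : ∀ t, (¬ ∃ i, sfun i = t) → cc t = 0 := by
    intro t h
    simp only [cc, dif_neg h]
  have hccnn : ∀ t, 0 ≤ cc t := by
    intro t
    by_cases h : ∃ i, sfun i = t
    · obtain ⟨i, rfl⟩ := h
      rw [hcc]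
      exact_mod_cast (hcpos i).le
    · rw [hcc0 t h]
  have hccsum : ∑ t, cc t = C := by
    rw [hCdef, Rat.cast_sum]
    symm
    apply Finset.sum_of_injOn sfun (fun a _ b _ h => hinj h)
    · intro i _
      simp
    · intro t _ ht
      apply hcc0
      rintro ⟨i, rfl⟩
      exact ht ⟨i, by simp, rfl⟩
    · intro i _
      exact (hcc i).symm
  have hss : ∀ u t, (groupPMC D shat sfun f g c).ev u (some shat) (some t)
      = D.ev u shat t - cc t * MvPolynomial.eval u f := by
    intro u t
    by_cases h : ∃ i, sfun i = t
    · obtain ⟨i, rfl⟩ := h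
      have h : ∃ j, sfun j = sfun i := ⟨i, rfl⟩
      have h2 : h.choose = i := hinj h.choose_spec
      rw [hcc]
      simp only [PMC.ev, groupPMC, groupP, if_true, dif_pos h, h2, hP]
      simp
    · rw [hcc0 t h]
      simp only [PMC.ev, groupPMC, groupP, if_true, dif_neg h]
      simp
  have hssg : ∀ u i, (groupPMC D shat sfun f g c).ev u (some shat) (some (sfun i))
      = MvPolynomial.eval u (g i) := by
    intro u i
    rw [hss, hcc, PMC.ev, hP]
    simp
  have hsn : ∀ u, (groupPMC D shat sfun f g c).ev u (some shat) none
      = C * MvPolynomial.eval u f := by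
    intro u
    simp only [PMC.ev, groupPMC, groupP, if_true, ← hCdef]
    simp
  have hns : ∀ u t, (groupPMC D shat sfun f g c).ev u none (some t) = cc t / C := by
    intro u t
    by_cases h : ∃ i, sfun i = t
    · simp only [PMC.ev, groupPMC, groupP, dif_pos h, cc, hCdef, MvPolynomial.eval_C,
        Rat.cast_div]
    · rw [hcc0 t h]
      simp only [PMC.ev, groupPMC, groupP, dif_neg h]
      simp
  have hnn : ∀ u, (groupPMC D shat sfun f g c).ev u none none = 0 := by
    intro u
    simp [PMC.ev, groupPMC, groupP]
  have hos : ∀ u s t, s ≠ shat →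
      (groupPMC D shat sfun f g c).ev u (some s) (some t) = D.ev u s t := by
    intro u s t h
    simp only [PMC.ev, groupPMC, groupP, if_neg h]
  have hon : ∀ u s, s ≠ shat → (groupPMC D shat sfun f g c).ev u (some s) none = 0 := by
    intro u s h
    simp [PMC.ev, groupPMC, groupP, if_neg h]
  have hsum : ∀ u s, ∑ b, (groupPMC D shat sfun f g c).ev u (some s) b
      = ∑ t, D.ev u s t := by
    intro u s
    rw [Fintype.sum_option]
    by_cases h : s = shat
    · subst h
      simp only [hsn, hss]
      rw [Finset.sum_sub_distrib, ← Finset.sum_mul, hccsum]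
      ring
    · simp only [hon u s h, hos u s _ h, zero_add]
  have hsumn : ∀ u, ∑ b, (groupPMC D shat sfun f g c).ev u none b = 1 := by
    intro u
    rw [Fintype.sum_option]
    simp only [hnn, hns, zero_add]
    rw [← Finset.sum_div, hccsum, div_self hC.ne']
  have hle : ∀ (h : Option S → ℝ), (∀ b, 0 ≤ h b) → ∑ b, h b = 1 → ∀ b, h b ≤ 1 := by
    intro h h0 h1 b
    rw [← h1]
    exact Finset.single_le_sum (fun i _ => h0 i) (Finset.mem_univ b)
  have hmain : ∀ u, WD D u → WD (groupPMC D shat sfun f g c) u := by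
    intro u hu
    refine ⟨?_, ?_⟩
    · rintro (_ | s) (_ | t)
      · rw [hnn]
      · rw [hns]
        exact div_nonneg (hccnn t) hC.le
      · by_cases h : s = shat
        · subst h
          rw [hsn]
          exact mul_nonneg hC.le (hf u hu)
        · rw [hon u s h]
      · by_cases h : s = shat
        · subst h
          by_cases ht : ∃ i, sfun i = t
          · obtain ⟨i, rfl⟩ := ht
            rw [hssg]
            exact hg u hu i
          · rw [hss, hcc0 t ht, zero_mul, sub_zero]
            exact hu.1 _ _
        · rw [hos u s t h]
          exact hu.1 _ _
    · rintro (_ | s)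
      · exact hsumn u
      · rw [hsum]
        exact hu.2 s
  have hconv : ∀ u, WD (groupPMC D shat sfun f g c) u → WD D u := by
    intro u hu
    refine ⟨?_, ?_⟩
    · intro s t
      have h1 := hu.1 (some s) (some t)
      by_cases h : s = shat
      · subst h
        have h2 := hu.1 (some s) none
        rw [hsn] at h2
        have h3 : 0 ≤ MvPolynomial.eval u f := nonneg_of_mul_nonneg_right h2 hC
        rw [hss] at h1
        have h4 := mul_nonneg (hccnn t) h3
        linarith
      · rwa [hos u s t h] at h1
    · intro s
      rw [← hsum]
      exact hu.2 (some s)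
  refine ⟨fun u hu => ?_, fun lo hi Dd => ?_⟩
  · have hw := hmain u hu
    exact ⟨fun b => ⟨hw.1 _ b, hle _ (hw.1 _) (hw.2 _) b⟩, hw.2 _,
      fun b => ⟨hw.1 _ b, hle _ (hw.1 _) (hw.2 _) b⟩, hw.2 _, hw⟩
  · ext u
    exact ⟨fun h => ⟨h.1, hconv u h.2⟩, fun h => ⟨h.1, hmain u h.2⟩⟩

end
end
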